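/- arXiv:1801.03516 — 2 statements merged into one kernel-verified Lean document; each statement's English description precedes it below -/
import Mathlib

section
/- Let d ≥ 1, let A and B be symmetric positive definite d×d real matrices, let U be uniformly distributed on the unit sphere of ℝ^d, and let R be a nonnegative real random variable with finite second moment, independent of U. Let μ be the law of R·A·U and ν the law of R·B·U. Then W₂²(μ, ν) = (E[R²]/d) · ( tr(A²) + tr(B²) − 2·tr((B·A²·B)^{1/2}) ). -/
open MeasureTheory ProbabilityTheory Matrix Finset
open scoped ENNReal

noncomputable section

/-- A coupling of `μ` and `ν`: a probability measure on the product with the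
prescribed marginals. -/
def IsCoupling {d : ℕ} (π : Measure ((Fin d → ℝ) × (Fin d → ℝ)))
    (μ ν : Measure (Fin d → ℝ)) : Prop :=
  IsProbabilityMeasure π ∧ π.map Prod.fst = μ ∧ π.map Prod.snd = ν

/-- Squared Euclidean distance on `ℝ^d`. -/
def sqDist {d : ℕ} (x y : Fin d → ℝ) : ℝ := ∑ i, (x i - y i) ^ 2

/-- The squared 2-Wasserstein distance: infimum of the quadratic transport cost
over all couplings. -/
def W2sq {d : ℕ} (μ ν : Measure (Fin d → ℝ)) : ℝ≥0∞ :=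
  ⨅ (π : Measure ((Fin d → ℝ) × (Fin d → ℝ))) (_ : IsCoupling π μ ν),
    ∫⁻ p, ENNReal.ofReal (sqDist p.1 p.2) ∂π

/-- Quantile (generalized inverse cdf) of a measure on `ℝ`. -/
def quantile (μ : Measure ℝ) (t : ℝ) : ℝ := sInf {s : ℝ | t ≤ cdf μ s}


/-- The uniform distribution on the unit sphere of `ℝ^d`, realized as a normalized
standard Gaussian vector. -/
def uniformSphere (d : ℕ) : Measure (Fin d → ℝ) :=
  (Measure.pi fun _ : Fin d => gaussianReal 0 1).map fun z =>
    (Real.sqrt (∑ i, z i ^ 2))⁻¹ • z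

/-- The Euclidean norm on `ℝ^d`. -/
def l2norm {d : ℕ} (x : Fin d → ℝ) : ℝ := Real.sqrt (∑ i, x i ^ 2)

lemma sum_sq_mulVec_of_orthogonal {d : ℕ} {O : Matrix (Fin d) (Fin d) ℝ} (hO : Oᵀ * O = 1)
    (x : Fin d → ℝ) : ∑ i, (O *ᵥ x) i ^ 2 = ∑ i, x i ^ 2 := by
  have h : (O *ᵥ x) ⬝ᵥ (O *ᵥ x) = x ⬝ᵥ x := by
    rw [dotProduct_mulVec, vecMul_mulVec, ← dotProduct_mulVec, hO, one_mulVec]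
  simpa [dotProduct, sq] using h

/-- The standard Gaussian measure on `ℝ^d` is invariant under orthogonal matrices. -/
lemma map_pi_gaussianReal_mulVec {d : ℕ} {O : Matrix (Fin d) (Fin d) ℝ} (hO : Oᵀ * O = 1) :
    (Measure.pi fun _ : Fin d => gaussianReal 0 1).map (fun z => O *ᵥ z) =
      Measure.pi fun _ : Fin d => gaussianReal 0 1 := by
  let f : EuclideanSpace ℝ (Fin d) →ₗᵢ[ℝ] EuclideanSpace ℝ (Fin d) :=
    { toLinearMap := Matrix.toEuclideanLin O
      norm_map' := fun x => by
        rw [EuclideanSpace.norm_eq, EuclideanSpace.norm_eq]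
        congr 1
        simpa using sum_sq_mulVec_of_orthogonal hO x.ofLp }
  have hf := stdGaussian_map (f.toLinearIsometryEquiv rfl)
  rw [← map_pi_eq_stdGaussian, Measure.map_map (by fun_prop) (by fun_prop)] at hf
  have h := congrArg (Measure.map (WithLp.ofLp : EuclideanSpace ℝ (Fin d) → Fin d → ℝ)) hf
  rw [Measure.map_map (by fun_prop) (by fun_prop), Measure.map_map (by fun_prop) (by fun_prop)] at h
  have hid : (WithLp.ofLp : EuclideanSpace ℝ (Fin d) → Fin d → ℝ) ∘ WithLp.toLp 2 = id := rfl
  rw [hid, Measure.map_id] at h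
  exact h

lemma measurable_mulVec {d : ℕ} (M : Matrix (Fin d) (Fin d) ℝ) :
    Measurable fun x : Fin d → ℝ => M *ᵥ x :=
  (Continuous.matrix_mulVec continuous_const continuous_id).measurable

/-- The uniform distribution on the sphere is invariant under orthogonal matrices. -/
lemma map_uniformSphere_mulVec {d : ℕ} {O : Matrix (Fin d) (Fin d) ℝ} (hO : Oᵀ * O = 1) :
    (uniformSphere d).map (fun z => O *ᵥ z) = uniformSphere d := by
  have hn : Measurable fun z : Fin d → ℝ => (Real.sqrt (∑ i, z i ^ 2))⁻¹ • z := by fun_prop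
  have hm := measurable_mulVec O
  rw [uniformSphere, Measure.map_map hm hn]
  conv_rhs => rw [← map_pi_gaussianReal_mulVec hO, Measure.map_map hn hm]
  congr 1
  ext z : 1
  simp [sum_sq_mulVec_of_orthogonal hO, mulVec_smul]

lemma sum_sq_uniformSphere {d : ℕ} (hd : 1 ≤ d) :
    ∀ᵐ u ∂uniformSphere d, ∑ i, u i ^ 2 = 1 := by
  have hn : Measurable fun z : Fin d → ℝ => (Real.sqrt (∑ i, z i ^ 2))⁻¹ • z := by fun_prop
  have : Nonempty (Fin d) := ⟨⟨0, hd⟩⟩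
  have : NullSingletonClass (gaussianReal 0 1) := nullSingletonClass_gaussianReal one_ne_zero
  rw [uniformSphere, ae_map_iff hn.aemeasurable (measurableSet_eq_fun (by fun_prop) (by fun_prop))]
  filter_upwards [Measure.ae_ne (Measure.pi fun _ : Fin d => gaussianReal 0 1) 0] with z hz
  have h0 : 0 < ∑ i, z i ^ 2 := by
    refine lt_of_le_of_ne (by positivity) fun h => hz ?_
    ext i
    have := (Finset.sum_eq_zero_iff_of_nonneg fun i _ => sq_nonneg (z i)).1 h.symm i (mem_univ i)
    simpa using this
  simp only [Pi.smul_apply, smul_eq_mul, mul_pow, ← Finset.mul_sum]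
  rw [inv_pow, Real.sq_sqrt h0.le, inv_mul_cancel₀ h0.ne']

instance isProbabilityMeasure_uniformSphere (d : ℕ) : IsProbabilityMeasure (uniformSphere d) :=
  Measure.isProbabilityMeasure_map (by fun_prop)

lemma integrable_mul_uniformSphere {d : ℕ} (hd : 1 ≤ d) (i j : Fin d) :
    Integrable (fun u : Fin d → ℝ => u i * u j) (uniformSphere d) := by
  refine Integrable.of_bound (by fun_prop) 1 ?_
  filter_upwards [sum_sq_uniformSphere hd] with u hu
  have h (k : Fin d) : u k ^ 2 ≤ 1 :=
    hu ▸ Finset.single_le_sum (f := fun k => u k ^ 2) (fun k _ => sq_nonneg _) (mem_univ k)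
  rw [Real.norm_eq_abs, abs_le]
  constructor <;> nlinarith [h i, h j, sq_nonneg (u i + u j), sq_nonneg (u i - u j)]

lemma integral_comp_mulVec_uniformSphere {d : ℕ} {O : Matrix (Fin d) (Fin d) ℝ}
    (hO : Oᵀ * O = 1) {f : (Fin d → ℝ) → ℝ} (hf : Measurable f) :
    ∫ u, f (O *ᵥ u) ∂uniformSphere d = ∫ u, f u ∂uniformSphere d := by
  conv_rhs => rw [← map_uniformSphere_mulVec hO]
  rw [integral_map (measurable_mulVec O).aemeasurable hf.aestronglyMeasurable]

lemma integral_mul_uniformSphere {d : ℕ} (hd : 1 ≤ d) (i j : Fin d) :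
    ∫ u, u i * u j ∂uniformSphere d = if i = j then (d : ℝ)⁻¹ else 0 := by
  split_ifs with hij
  · subst hij
    have heq (k : Fin d) : ∫ u, u k * u k ∂uniformSphere d = ∫ u, u i * u i ∂uniformSphere d := by
      have hO : ((Equiv.swap i k).toPEquiv.toMatrix : Matrix (Fin d) (Fin d) ℝ)ᵀ *
          (Equiv.swap i k).toPEquiv.toMatrix = 1 := by
        rw [← PEquiv.toMatrix_symm, ← PEquiv.toMatrix_trans, ← Equiv.toPEquiv_symm,
          ← Equiv.toPEquiv_trans, Equiv.symm_trans_self, Equiv.toPEquiv_refl, PEquiv.toMatrix_refl]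
      have := integral_comp_mulVec_uniformSphere hO (f := fun u => u i * u i) (by fun_prop)
      simpa [PEquiv.toMatrix_toPEquiv_mulVec] using this
    have hsum : ∑ k, ∫ u, u k * u k ∂uniformSphere d = 1 := by
      rw [← integral_finsetSum _ fun k _ => integrable_mul_uniformSphere hd k k]
      have : (fun u : Fin d → ℝ => ∑ k, u k * u k) =ᵐ[uniformSphere d] fun _ => 1 := by
        filter_upwards [sum_sq_uniformSphere hd] with u hu
        simpa [sq] using hu
      simp [integral_congr_ae this]
    simp only [heq, sum_const, card_univ, Fintype.card_fin, nsmul_eq_mul] at hsum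
    exact eq_inv_of_mul_eq_one_right hsum
  · have hO : (Matrix.diagonal (fun k => if k = i then (-1 : ℝ) else 1))ᵀ *
        Matrix.diagonal (fun k => if k = i then (-1 : ℝ) else 1) = 1 := by
      rw [diagonal_transpose, diagonal_mul_diagonal, ← diagonal_one]
      congr 1
      ext k
      split_ifs <;> norm_num
    have := integral_comp_mulVec_uniformSphere hO (f := fun u => u i * u j) (by fun_prop)
    simp only [mulVec_diagonal, if_true, if_neg (Ne.symm hij), one_mul, neg_mul,
      integral_neg] at this
    linarith

lemma dotProduct_mulVec_eq_sum {d : ℕ} (N : Matrix (Fin d) (Fin d) ℝ) (u : Fin d → ℝ) :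
    u ⬝ᵥ N *ᵥ u = ∑ i, ∑ j, N i j * (u i * u j) := by
  simp only [dotProduct, mulVec, Finset.mul_sum]
  exact Finset.sum_congr rfl fun i _ => Finset.sum_congr rfl fun j _ => by ring

lemma integrable_quadratic_uniformSphere {d : ℕ} (hd : 1 ≤ d) (N : Matrix (Fin d) (Fin d) ℝ) :
    Integrable (fun u => u ⬝ᵥ N *ᵥ u) (uniformSphere d) := by
  simp only [dotProduct_mulVec_eq_sum]
  exact integrable_finsetSum _ fun i _ => integrable_finsetSum _ fun j _ =>
    (integrable_mul_uniformSphere hd i j).const_mul _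

lemma integral_quadratic_uniformSphere {d : ℕ} (hd : 1 ≤ d) (N : Matrix (Fin d) (Fin d) ℝ) :
    ∫ u, u ⬝ᵥ N *ᵥ u ∂uniformSphere d = N.trace / d := by
  have h (i j : Fin d) := (integrable_mul_uniformSphere hd i j).const_mul (N i j)
  simp only [dotProduct_mulVec_eq_sum]
  rw [integral_finsetSum _ fun i _ => integrable_finsetSum _ fun j _ => h i j]
  simp_rw [integral_finsetSum _ fun j _ => h _ j, integral_const_mul,
    integral_mul_uniformSphere hd]
  simp [Matrix.trace, div_eq_mul_inv, Finset.sum_mul]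

section Elliptical

variable {d : ℕ} {Ω : Type*} [MeasureSpace Ω] {U : Ω → Fin d → ℝ} {R : Ω → ℝ}

lemma measurable_quadratic (N : Matrix (Fin d) (Fin d) ℝ) :
    Measurable fun u : Fin d → ℝ => u ⬝ᵥ N *ᵥ u := by
  simp only [dotProduct_mulVec_eq_sum]
  fun_prop

lemma measurable_smul_mulVec (hU : Measurable U) (hR : Measurable R)
    (A : Matrix (Fin d) (Fin d) ℝ) : Measurable fun ω => R ω • (A *ᵥ U ω) :=
  hR.smul ((measurable_mulVec A).comp hU)

lemma smul_mulVec_quadratic (r : ℝ) (A N : Matrix (Fin d) (Fin d) ℝ) (u : Fin d → ℝ) :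
    (r • (A *ᵥ u)) ⬝ᵥ N *ᵥ (r • (A *ᵥ u)) = r ^ 2 * (u ⬝ᵥ (Aᵀ * N * A) *ᵥ u) := by
  simp only [mulVec_smul, dotProduct_smul, smul_dotProduct, smul_eq_mul]
  rw [← mulVec_mulVec, ← mulVec_mulVec, dotProduct_mulVec u, vecMul_transpose]
  ring

lemma integrable_sq_mul_quadratic (hd : 1 ≤ d) (hU : Measurable U)
    (hUlaw : Measure.map U ℙ = uniformSphere d) (hR2 : Integrable (fun ω => R ω ^ 2) ℙ)
    (hRU : IndepFun R U ℙ) (N : Matrix (Fin d) (Fin d) ℝ) :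
    Integrable (fun ω => R ω ^ 2 * (U ω ⬝ᵥ N *ᵥ U ω)) ℙ := by
  have hq := integrable_quadratic_uniformSphere hd N
  rw [← hUlaw] at hq
  exact (hRU.comp (measurable_id.pow_const 2) (measurable_quadratic N)).integrable_mul hR2
    (hq.comp_measurable hU)

lemma integral_sq_mul_quadratic (hd : 1 ≤ d) (hU : Measurable U) (hR : Measurable R)
    (hUlaw : Measure.map U ℙ = uniformSphere d)
    (hRU : IndepFun R U ℙ) (N : Matrix (Fin d) (Fin d) ℝ) :
    ∫ ω, R ω ^ 2 * (U ω ⬝ᵥ N *ᵥ U ω) ∂ℙ = (∫ ω, R ω ^ 2 ∂ℙ) / d * N.trace := by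
  have hq := integral_quadratic_uniformSphere hd N
  rw [← hUlaw, integral_map hU.aemeasurable (measurable_quadratic N).aestronglyMeasurable] at hq
  have := (hRU.comp (measurable_id.pow_const 2)
    (measurable_quadratic N)).integral_fun_mul_eq_mul_integral
    (hR.pow_const 2).aestronglyMeasurable ((measurable_quadratic N).comp hU).aestronglyMeasurable
  simp only [Function.comp_apply, id_eq] at this
  rw [this, hq]
  ring

lemma integrable_quadratic_map (hd : 1 ≤ d) (hU : Measurable U) (hR : Measurable R)
    (hUlaw : Measure.map U ℙ = uniformSphere d) (hR2 : Integrable (fun ω => R ω ^ 2) ℙ)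
    (hRU : IndepFun R U ℙ) (A N : Matrix (Fin d) (Fin d) ℝ) :
    Integrable (fun x => x ⬝ᵥ N *ᵥ x) (Measure.map (fun ω => R ω • (A *ᵥ U ω)) ℙ) := by
  rw [integrable_map_measure (measurable_quadratic N).aestronglyMeasurable
    (measurable_smul_mulVec hU hR A).aemeasurable]
  simpa only [Function.comp_def, smul_mulVec_quadratic] using
    integrable_sq_mul_quadratic hd hU hUlaw hR2 hRU (Aᵀ * N * A)

lemma integral_quadratic_map (hd : 1 ≤ d) (hU : Measurable U) (hR : Measurable R)
    (hUlaw : Measure.map U ℙ = uniformSphere d)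
    (hRU : IndepFun R U ℙ) (A N : Matrix (Fin d) (Fin d) ℝ) :
    ∫ x, x ⬝ᵥ N *ᵥ x ∂(Measure.map (fun ω => R ω • (A *ᵥ U ω)) ℙ) =
      (∫ ω, R ω ^ 2 ∂ℙ) / d * (Aᵀ * N * A).trace := by
  rw [integral_map (measurable_smul_mulVec hU hR A).aemeasurable
    (measurable_quadratic N).aestronglyMeasurable]
  simpa only [smul_mulVec_quadratic] using
    integral_sq_mul_quadratic hd hU hR hUlaw hRU (Aᵀ * N * A)

/-- Replacing `U` by its image under an orthogonal matrix does not change the law of `R • M U`. -/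
lemma map_smul_mulVec_orthogonal [IsProbabilityMeasure (ℙ : Measure Ω)]
    (hU : Measurable U) (hR : Measurable R)
    (hUlaw : Measure.map U ℙ = uniformSphere d) (hRU : IndepFun R U ℙ)
    (B : Matrix (Fin d) (Fin d) ℝ) {O : Matrix (Fin d) (Fin d) ℝ} (hO : Oᵀ * O = 1) :
    Measure.map (fun ω => R ω • ((B * O) *ᵥ U ω)) ℙ =
      Measure.map (fun ω => R ω • (B *ᵥ U ω)) ℙ := by
  have hOU : Measurable fun ω => O *ᵥ U ω := (measurable_mulVec O).comp hU
  have hlaw : Measure.map (fun ω => O *ᵥ U ω) ℙ = Measure.map U ℙ := by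
    rw [hUlaw, ← map_uniformSphere_mulVec hO, ← hUlaw,
      Measure.map_map (measurable_mulVec O) hU]
    rfl
  have h1 := (indepFun_iff_map_prod_eq_prod_map_map hR.aemeasurable hU.aemeasurable).1 hRU
  have h2 := (indepFun_iff_map_prod_eq_prod_map_map hR.aemeasurable hOU.aemeasurable).1
    (hRU.comp measurable_id (measurable_mulVec O))
  rw [hlaw, ← h1] at h2
  have hg : Measurable fun p : ℝ × (Fin d → ℝ) => p.1 • (B *ᵥ p.2) :=
    measurable_fst.smul ((measurable_mulVec B).comp measurable_snd)
  have h3 := congrArg (Measure.map fun p : ℝ × (Fin d → ℝ) => p.1 • (B *ᵥ p.2)) h2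
  rw [Measure.map_map hg (hR.prodMk hOU), Measure.map_map hg (hR.prodMk hU)] at h3
  simpa only [Function.comp_def, mulVec_mulVec] using h3

end Elliptical

lemma ofReal_integral_le_lintegral {α : Type*} [MeasurableSpace α] {π : Measure α} {f g : α → ℝ}
    (hf : Integrable f π) (hfg : ∀ x, f x ≤ g x) :
    ENNReal.ofReal (∫ x, f x ∂π) ≤ ∫⁻ x, ENNReal.ofReal (g x) ∂π := by
  rw [integral_eq_lintegral_pos_part_sub_lintegral_neg_part hf]
  refine (ENNReal.ofReal_le_ofReal (sub_le_self _ ENNReal.toReal_nonneg)).trans ?_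
  exact ENNReal.ofReal_toReal_le.trans
    (lintegral_mono fun x => ENNReal.ofReal_le_ofReal (hfg x))

lemma sqDist_eq_dotProduct {d : ℕ} (x y : Fin d → ℝ) : sqDist x y = (x - y) ⬝ᵥ (x - y) := by
  simp [sqDist, dotProduct, sq]

/-- Weak duality for the quadratic cost: the potentials are the quadratic forms of `1 - T` and
`1 - T⁻¹`. -/
lemma quadratic_add_le_sqDist {d : ℕ} {T S : Matrix (Fin d) (Fin d) ℝ} (hT : T.PosSemidef)
    (hS : S.IsHermitian) (hTS : T * S = 1) (x y : Fin d → ℝ) :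
    x ⬝ᵥ (1 - T) *ᵥ x + y ⬝ᵥ (1 - S) *ᵥ y ≤ sqDist x y := by
  have h := hT.dotProduct_mulVec_nonneg (x - S *ᵥ y)
  have hSt : Sᵀ = S := by simpa using hS.eq
  have h1 : (S *ᵥ y) ⬝ᵥ T *ᵥ x = y ⬝ᵥ x := by
    have hST : S * T = 1 := mul_eq_one_comm.1 hTS
    have hv : S *ᵥ y = y ᵥ* S := by rw [← vecMul_transpose, hSt]
    rw [hv, ← dotProduct_mulVec, mulVec_mulVec, hST, one_mulVec]
  have h2 : (S *ᵥ y) ⬝ᵥ y = y ⬝ᵥ S *ᵥ y := dotProduct_comm _ _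
  simp only [star_trivial, mulVec_sub, mulVec_mulVec, hTS, one_mulVec, dotProduct_sub,
    sub_dotProduct, h1, h2] at h
  simp only [sqDist_eq_dotProduct, sub_mulVec, one_mulVec, dotProduct_sub, sub_dotProduct]
  rw [dotProduct_comm y x] at h ⊢
  linarith

theorem wasserstein_distance_elliptical_related_class
    {d : ℕ} (hd : 1 ≤ d)
    {Ω : Type*} [MeasureSpace Ω] [IsProbabilityMeasure (ℙ : Measure Ω)]
    (A B : Matrix (Fin d) (Fin d) ℝ) (hA : A.PosDef) (hB : B.PosDef)
    (U : Ω → Fin d → ℝ) (R : Ω → ℝ)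
    (hUmeas : Measurable U) (hRmeas : Measurable R)
    (hUlaw : Measure.map U ℙ = uniformSphere d)
    (hRpos : ∀ ω, 0 ≤ R ω)
    (hR2 : Integrable (fun ω => R ω ^ 2) ℙ)
    (hRU : IndepFun R U ℙ)
    (μ ν : Measure (Fin d → ℝ))
    (hμ : μ = Measure.map (fun ω => R ω • (A *ᵥ U ω)) ℙ)
    (hν : ν = Measure.map (fun ω => R ω • (B *ᵥ U ω)) ℙ)
    -- `C` is the unique symmetric positive semidefinite square root of `B * A² * B`
    (C : Matrix (Fin d) (Fin d) ℝ) (hC : C.PosSemidef) (hC2 : C * C = B * (A * A) * B) :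
    W2sq μ ν = ENNReal.ofReal
      ((∫ ω, R ω ^ 2 ∂ℙ) / d * ((A * A).trace + (B * B).trace - 2 * C.trace)) := by
  have hAt : Aᵀ = A := by simpa using hA.isHermitian.eq
  have hBt : Bᵀ = B := by simpa using hB.isHermitian.eq
  have hCt : Cᵀ = C := by simpa using hC.isHermitian.eq
  have hAu : IsUnit A.det := (isUnit_iff_isUnit_det A).1 hA.isUnit
  have hBu : IsUnit B.det := (isUnit_iff_isUnit_det B).1 hB.isUnit
  have hCu : IsUnit C.det := by
    have h := congrArg Matrix.det hC2
    simp only [det_mul] at h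
    refine isUnit_of_mul_isUnit_left (y := C.det) ?_
    rw [h]
    exact (hBu.mul (hAu.mul hAu)).mul hBu
  have hCit : (C⁻¹)ᵀ = C⁻¹ := by rw [transpose_nonsing_inv, hCt]
  have hBit : (B⁻¹)ᵀ = B⁻¹ := by rw [transpose_nonsing_inv, hBt]
  have hquot : C⁻¹ * (B * (A * A) * B) = C := by
    rw [← hC2, nonsing_inv_mul_cancel_left _ _ hCu]
  set s := (∫ ω, R ω ^ 2 ∂ℙ) / d
  refine le_antisymm ?_ (le_iInf₂ fun π hπ => ?_)
  · let O := C⁻¹ * B * A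
    have hOO : O * Oᵀ = 1 := by
      have : O * Oᵀ = C⁻¹ * (B * (A * A) * B) * C⁻¹ := by
        simp only [O, transpose_mul, hAt, hBt, hCit, Matrix.mul_assoc]
      rw [this, hquot, mul_nonsing_inv _ hCu]
    have hO : Oᵀ * O = 1 := mul_eq_one_comm.1 hOO
    have hX := measurable_smul_mulVec hUmeas hRmeas A
    have hY := measurable_smul_mulVec hUmeas hRmeas (B * O)
    have hπ : IsCoupling (Measure.map
        (fun ω => (R ω • (A *ᵥ U ω), R ω • ((B * O) *ᵥ U ω))) ℙ) μ ν := by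
      refine ⟨Measure.isProbabilityMeasure_map (hX.prodMk hY).aemeasurable, ?_, ?_⟩
      · rw [Measure.map_map measurable_fst (hX.prodMk hY), hμ]
        rfl
      · rw [Measure.map_map measurable_snd (hX.prodMk hY), hν,
          ← map_smul_mulVec_orthogonal hUmeas hRmeas hUlaw hRU B hO]
        rfl
    refine le_trans (iInf₂_le (f := fun π (_ : IsCoupling π μ ν) =>
      ∫⁻ p, ENNReal.ofReal (sqDist p.1 p.2) ∂π) _ hπ) (le_of_eq ?_)
    have hcost (ω : Ω) : sqDist (R ω • (A *ᵥ U ω)) (R ω • ((B * O) *ᵥ U ω)) =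
        R ω ^ 2 * (U ω ⬝ᵥ ((A - B * O)ᵀ * 1 * (A - B * O)) *ᵥ U ω) := by
      rw [← smul_mulVec_quadratic, sqDist_eq_dotProduct, ← smul_sub, ← sub_mulVec, one_mulVec]
    have htr : ((A - B * O)ᵀ * 1 * (A - B * O)).trace =
        (A * A).trace + (B * B).trace - 2 * C.trace := by
      have h1 : (A * (B * O)).trace = C.trace := by
        rw [← Matrix.mul_assoc, trace_mul_comm]
        simp only [O, Matrix.mul_assoc]
        conv_rhs => rw [← hquot]
        simp only [Matrix.mul_assoc]
      have h2 : ((B * O)ᵀ * A).trace = C.trace := by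
        rw [← h1, ← trace_transpose, transpose_mul, transpose_transpose, hAt]
      have h3 : ((B * O)ᵀ * (B * O)).trace = (B * B).trace := by
        rw [trace_mul_comm, transpose_mul, hBt, Matrix.mul_assoc, ← Matrix.mul_assoc O, hOO,
          Matrix.one_mul]
      rw [Matrix.mul_one, transpose_sub, hAt, Matrix.sub_mul, Matrix.mul_sub, Matrix.mul_sub,
        trace_sub, trace_sub, trace_sub, h1, h2, h3]
      ring
    have hmeas : Measurable fun p : (Fin d → ℝ) × (Fin d → ℝ) =>
        ENNReal.ofReal (sqDist p.1 p.2) := by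
      unfold sqDist
      fun_prop
    rw [lintegral_map hmeas (hX.prodMk hY), ← htr,
      ← integral_sq_mul_quadratic hd hUmeas hRmeas hUlaw hRU,
      ofReal_integral_eq_lintegral_ofReal
        (integrable_sq_mul_quadratic hd hUmeas hUlaw hR2 hRU _)]
    · simp only [hcost]
    · refine Filter.Eventually.of_forall fun ω => ?_
      simp only [← hcost, sqDist]
      positivity
  · obtain ⟨-, hfst, hsnd⟩ := hπ
    let T := B * C⁻¹ * B
    let S := B⁻¹ * C * B⁻¹
    have hT : T.PosSemidef := by
      simpa [T, hBt] using hC.inv.mul_mul_conjTranspose_same B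
    have hS : S.IsHermitian := by
      simpa [S, hBit] using (hC.mul_mul_conjTranspose_same B⁻¹).isHermitian
    have hTS : T * S = 1 := by
      simp only [T, S, Matrix.mul_assoc, mul_nonsing_inv_cancel_left _ _ hBu,
        nonsing_inv_mul_cancel_left _ _ hCu, mul_nonsing_inv _ hBu]
    have hIμ : Integrable (fun p => p.1 ⬝ᵥ (1 - T) *ᵥ p.1) π := by
      have h := integrable_quadratic_map hd hUmeas hRmeas hUlaw hR2 hRU A (1 - T)
      rw [← hμ, ← hfst] at h
      exact h.comp_measurable measurable_fst
    have hIν : Integrable (fun p => p.2 ⬝ᵥ (1 - S) *ᵥ p.2) π := by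
      have h := integrable_quadratic_map hd hUmeas hRmeas hUlaw hR2 hRU B (1 - S)
      rw [← hν, ← hsnd] at h
      exact h.comp_measurable measurable_snd
    have hEμ : ∫ p, p.1 ⬝ᵥ (1 - T) *ᵥ p.1 ∂π = s * ((A * A).trace - C.trace) := by
      have h := integral_quadratic_map hd hUmeas hRmeas hUlaw hRU A (1 - T)
      rw [← hμ, ← hfst, integral_map measurable_fst.aemeasurable
        (measurable_quadratic _).aestronglyMeasurable] at h
      have h1 : (A * T * A).trace = C.trace := by
        rw [show A * T * A = (A * B) * (C⁻¹ * (B * A)) by simp only [T, Matrix.mul_assoc],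
          trace_mul_comm]
        conv_rhs => rw [← hquot]
        simp only [Matrix.mul_assoc]
      rw [h, hAt, Matrix.mul_sub, Matrix.sub_mul, trace_sub, h1, Matrix.mul_one]
    have hEν : ∫ p, p.2 ⬝ᵥ (1 - S) *ᵥ p.2 ∂π = s * ((B * B).trace - C.trace) := by
      have h := integral_quadratic_map hd hUmeas hRmeas hUlaw hRU B (1 - S)
      rw [← hν, ← hsnd, integral_map measurable_snd.aemeasurable
        (measurable_quadratic _).aestronglyMeasurable] at h
      have h1 : B * S * B = C := by
        simp only [S, Matrix.mul_assoc, mul_nonsing_inv_cancel_left _ _ hBu,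
          nonsing_inv_mul _ hBu, Matrix.mul_one]
      rw [h, hBt, Matrix.mul_sub, Matrix.sub_mul, trace_sub, h1, Matrix.mul_one]
    have hE : ∫ p, (p.1 ⬝ᵥ (1 - T) *ᵥ p.1 + p.2 ⬝ᵥ (1 - S) *ᵥ p.2) ∂π =
        s * ((A * A).trace + (B * B).trace - 2 * C.trace) := by
      rw [integral_add hIμ hIν, hEμ, hEν]
      ring
    rw [← hE]
    exact ofReal_integral_le_lintegral (hIμ.add hIν)
      fun p => quadratic_add_le_sqDist hT hS hTS p.1 p.2
end
end

section
/- Let d ≥ 1, let α : [0,∞) → [0,∞) be nondecreasing, and define the radial transform φ : ℝ^d → ℝ^d by φ(x) = (α(‖x‖₂)/‖x‖₂)·x for x ≠ 0 and φ(0) = 0. Let X be a random vector in ℝ^d with E[‖X‖₂²] < ∞ and E[‖φ(X)‖₂²] < ∞. Then the law of the pair (X, φ(X)) is an optimal coupling of the law of X and the law of φ(X); that is, E[‖X − φ(X)‖₂²] equals the infimum of ∫ ‖x − y‖₂² dπ(x,y) over all couplings π of the law of X and the law of φ(X). -/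
open MeasureTheory ProbabilityTheory Matrix Finset
open scoped ENNReal

noncomputable section

theorem measurable_sqDist {d : ℕ} :
    Measurable fun p : (Fin d → ℝ) × (Fin d → ℝ) => sqDist p.1 p.2 := by
  unfold sqDist
  fun_prop

theorem sqDist_add_two_mul_sum {d : ℕ} (x y : Fin d → ℝ) :
    sqDist x y + 2 * ∑ i, x i * y i = ∑ i, x i ^ 2 + ∑ i, y i ^ 2 := by
  simp only [sqDist, Finset.mul_sum, ← Finset.sum_add_distrib]
  exact Finset.sum_congr rfl fun i _ => by ring

theorem sqDist_nonneg {d : ℕ} (x y : Fin d → ℝ) : 0 ≤ sqDist x y :=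
  Finset.sum_nonneg fun _ _ => sq_nonneg _

theorem l2norm_nonneg {d : ℕ} (x : Fin d → ℝ) : 0 ≤ l2norm x := Real.sqrt_nonneg _

theorem l2norm_sq {d : ℕ} (x : Fin d → ℝ) : l2norm x ^ 2 = ∑ i, x i ^ 2 :=
  Real.sq_sqrt (Finset.sum_nonneg fun _ _ => sq_nonneg _)

theorem measurable_l2norm {d : ℕ} : Measurable (l2norm : (Fin d → ℝ) → ℝ) := by
  unfold l2norm
  fun_prop

theorem l2norm_pos {d : ℕ} {x : Fin d → ℝ} (hx : x ≠ 0) : 0 < l2norm x := by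
  obtain ⟨i, hi⟩ := Function.ne_iff.mp hx
  exact Real.sqrt_pos.mpr
    (Finset.sum_pos' (fun _ _ => sq_nonneg _) ⟨i, Finset.mem_univ i, sq_pos_of_ne_zero hi⟩)

theorem l2norm_smul {d : ℕ} {c : ℝ} (hc : 0 ≤ c) (x : Fin d → ℝ) :
    l2norm (c • x) = c * l2norm x := by
  simp only [l2norm, Pi.smul_apply, smul_eq_mul, mul_pow, ← Finset.mul_sum]
  rw [Real.sqrt_mul (sq_nonneg c), Real.sqrt_sq hc]

/-- Weak Kantorovich duality: a coupling concentrated on the contact set of a pair of integrable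
dual potentials has minimal quadratic cost. -/
theorem lintegral_sqDist_eq_W2sq_of_potentials {d : ℕ}
    {π : Measure ((Fin d → ℝ) × (Fin d → ℝ))} {μ ν : Measure (Fin d → ℝ)}
    (hπ : IsCoupling π μ ν) {f g : (Fin d → ℝ) → ℝ≥0∞} (hf : Measurable f) (hg : Measurable g)
    (hf_fin : ∫⁻ x, f x ∂μ ≠ ∞) (hg_fin : ∫⁻ y, g y ∂ν ≠ ∞)
    (hle : ∀ x y, ENNReal.ofReal (∑ i, x i ^ 2) + ENNReal.ofReal (∑ i, y i ^ 2) ≤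
      ENNReal.ofReal (sqDist x y) + (f x + g y))
    (heq : ∀ᵐ p ∂π, ENNReal.ofReal (sqDist p.1 p.2) + (f p.1 + g p.2) =
      ENNReal.ofReal (∑ i, p.1 i ^ 2) + ENNReal.ofReal (∑ i, p.2 i ^ 2)) :
    ∫⁻ p, ENNReal.ofReal (sqDist p.1 p.2) ∂π = W2sq μ ν := by
  have split : ∀ {u v : (Fin d → ℝ) → ℝ≥0∞}, Measurable u → Measurable v →
      ∀ {ρ}, IsCoupling ρ μ ν →
        ∫⁻ p, (u p.1 + v p.2) ∂ρ = ∫⁻ x, u x ∂μ + ∫⁻ y, v y ∂ν := by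
    intro u v hu hv ρ hρ
    have hu' : Measurable fun p : (Fin d → ℝ) × (Fin d → ℝ) => u p.1 := hu.comp measurable_fst
    rw [lintegral_add_left hu', ← hρ.2.1, ← hρ.2.2, lintegral_map hu measurable_fst,
      lintegral_map hv measurable_snd]
  have hN : Measurable fun x : Fin d → ℝ => ENNReal.ofReal (∑ i, x i ^ 2) := by fun_prop
  refine le_antisymm (le_iInf₂ fun ρ hρ => ?_) (iInf₂_le π hπ)
  refine (ENNReal.add_le_add_iff_right (ENNReal.add_ne_top.mpr ⟨hf_fin, hg_fin⟩)).mp ?_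
  calc ∫⁻ p, ENNReal.ofReal (sqDist p.1 p.2) ∂π + (∫⁻ x, f x ∂μ + ∫⁻ y, g y ∂ν)
      = ∫⁻ p, (ENNReal.ofReal (sqDist p.1 p.2) + (f p.1 + g p.2)) ∂π := by
        rw [lintegral_add_left measurable_sqDist.ennreal_ofReal, split hf hg hπ]
    _ = ∫⁻ p, (ENNReal.ofReal (∑ i, p.1 i ^ 2) + ENNReal.ofReal (∑ i, p.2 i ^ 2)) ∂π :=
        lintegral_congr_ae heq
    _ = ∫⁻ p, (ENNReal.ofReal (∑ i, p.1 i ^ 2) + ENNReal.ofReal (∑ i, p.2 i ^ 2)) ∂ρ := by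
        rw [split hN hN hπ, split hN hN hρ]
    _ ≤ ∫⁻ p, (ENNReal.ofReal (sqDist p.1 p.2) + (f p.1 + g p.2)) ∂ρ :=
        lintegral_mono fun p => hle p.1 p.2
    _ = ∫⁻ p, ENNReal.ofReal (sqDist p.1 p.2) ∂ρ + (∫⁻ x, f x ∂μ + ∫⁻ y, g y ∂ν) := by
        rw [lintegral_add_left measurable_sqDist.ennreal_ofReal, split hf hg hρ]

/-- The subgradient inequality for the primitive of a monotone function. -/
theorem Monotone.mul_sub_le_intervalIntegral {β : ℝ → ℝ} (hβ : Monotone β) (a b : ℝ) :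
    β a * (b - a) ≤ ∫ t in a..b, β t := by
  have hint : ∀ a b, IntervalIntegrable β volume a b := fun _ _ => hβ.intervalIntegrable
  rcases le_total a b with hab | hab
  · have := intervalIntegral.integral_mono_on hab intervalIntegrable_const (hint a b)
      fun t ht => hβ ht.1
    simpa [mul_comm] using this
  · have := intervalIntegral.integral_mono_on hab (hint b a) intervalIntegrable_const
      fun t ht => hβ ht.2
    rw [intervalIntegral.integral_symm]
    simp only [intervalIntegral.integral_const, smul_eq_mul] at this
    linarith

/-- Twice the convex conjugate of `A` on the half-line, truncated below at `0`. -/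
def radialConjugate (A : ℝ → ℝ) (s : ℝ) : ℝ≥0∞ :=
  ⨆ r : NNReal, ENNReal.ofReal (2 * (r * s - A r))

theorem monotone_radialConjugate (A : ℝ → ℝ) : Monotone (radialConjugate A) := fun s t hst =>
  iSup_mono fun r => ENNReal.ofReal_le_ofReal (by
    have := mul_le_mul_of_nonneg_left hst r.2
    simp only [NNReal.val_eq_coe] at this
    linarith)

theorem le_radialConjugate (A : ℝ → ℝ) {r : ℝ} (hr : 0 ≤ r) (s : ℝ) :
    ENNReal.ofReal (2 * (r * s - A r)) ≤ radialConjugate A s :=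
  le_iSup (fun r : NNReal => ENNReal.ofReal (2 * (r * s - A r))) ⟨r, hr⟩

theorem radialConjugate_eq {A : ℝ → ℝ} {r s : ℝ} (hr : 0 ≤ r)
    (h : ∀ r', 0 ≤ r' → A r + s * (r' - r) ≤ A r') :
    radialConjugate A s = ENNReal.ofReal (2 * (r * s - A r)) :=
  le_antisymm (iSup_le fun r' => ENNReal.ofReal_le_ofReal (by linarith [h r' r'.2]))
    (le_radialConjugate A hr s)

theorem radial_transform_optimal_coupling
    {d : ℕ} (hd : 1 ≤ d)
    {Ω : Type*} [MeasureSpace Ω] [IsProbabilityMeasure (ℙ : Measure Ω)]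
    (α : ℝ → ℝ)
    (hαmono : MonotoneOn α (Set.Ici 0))
    (hαnonneg : ∀ r, 0 ≤ r → 0 ≤ α r)
    (φ : (Fin d → ℝ) → Fin d → ℝ)
    (hφ : ∀ x, φ x = if x = 0 then 0 else (α (l2norm x) / l2norm x) • x)
    (X : Ω → Fin d → ℝ) (hXmeas : Measurable X)
    (hX2 : Integrable (fun ω => ∑ i, X ω i ^ 2) ℙ)
    (hφX2 : Integrable (fun ω => ∑ i, φ (X ω) i ^ 2) ℙ) :
    IsCoupling (Measure.map (fun ω => (X ω, φ (X ω))) ℙ)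
      (Measure.map X ℙ) (Measure.map (fun ω => φ (X ω)) ℙ) ∧
    (∫⁻ p, ENNReal.ofReal (sqDist p.1 p.2)
        ∂(Measure.map (fun ω => (X ω, φ (X ω))) ℙ)) =
      W2sq (Measure.map X ℙ) (Measure.map (fun ω => φ (X ω)) ℙ) := by
  set β : ℝ → ℝ := fun t => α (max t 0)
  have hβ : Monotone β := fun s t hst =>
    hαmono (le_max_right s 0) (le_max_right t 0) (max_le_max_right 0 hst)
  have hβ_nonneg : ∀ t, 0 ≤ β t := fun t => hαnonneg _ (le_max_right t 0)
  have hφβ : ∀ x, φ x = if x = 0 then 0 else (β (l2norm x) / l2norm x) • x := fun x => by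
    simp only [hφ, β, max_eq_left (l2norm_nonneg x)]
  have hφm : Measurable φ := by
    rw [funext hφβ]
    refine Measurable.ite (measurableSet_singleton 0) measurable_const ?_
    exact ((hβ.measurable.comp measurable_l2norm).div measurable_l2norm).smul measurable_id
  have hφX : Measurable fun ω => φ (X ω) := hφm.comp hXmeas
  have hcoup : IsCoupling (Measure.map (fun ω => (X ω, φ (X ω))) ℙ)
      (Measure.map X ℙ) (Measure.map (fun ω => φ (X ω)) ℙ) :=
    ⟨Measure.isProbabilityMeasure_map (hXmeas.prodMk hφX).aemeasurable,
      Measure.map_map measurable_fst (hXmeas.prodMk hφX),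
      Measure.map_map measurable_snd (hXmeas.prodMk hφX)⟩
  refine ⟨hcoup, ?_⟩
  set A : ℝ → ℝ := fun r => ∫ t in (0 : ℝ)..r, β t
  have hint : ∀ a b, IntervalIntegrable β volume a b := fun _ _ => hβ.intervalIntegrable
  have hA_meas : Measurable A := (intervalIntegral.continuous_primitive hint 0).measurable
  have hA_nonneg : ∀ r, 0 ≤ r → 0 ≤ A r := fun r hr =>
    intervalIntegral.integral_nonneg hr fun t _ => hβ_nonneg t
  have hA_sub : ∀ r r', A r + β r * (r' - r) ≤ A r' := fun r r' => by
    have h1 := hβ.mul_sub_le_intervalIntegral r r'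
    have h2 := intervalIntegral.integral_add_adjacent_intervals (hint 0 r) (hint r r')
    simp only [A]
    linarith
  have hinner : ∀ x, ∑ i, x i * φ x i = l2norm x * l2norm (φ x) := fun x => by
    by_cases hx : x = 0
    · simp [hx, l2norm]
    · have hpos := l2norm_pos hx
      have hc : 0 ≤ β (l2norm x) / l2norm x := div_nonneg (hβ_nonneg _) hpos.le
      simp only [hφβ, if_neg hx, l2norm_smul hc, Pi.smul_apply, smul_eq_mul]
      rw [mul_left_comm, ← sq, l2norm_sq, Finset.mul_sum]
      exact Finset.sum_congr rfl fun i _ => by ring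
  have hsub : ∀ x r', 0 ≤ r' → A (l2norm x) + l2norm (φ x) * (r' - l2norm x) ≤ A r' := by
    intro x r' hr'
    by_cases hx : x = 0
    · simpa [hφ, hx, l2norm, A] using hA_nonneg r' hr'
    · have hpos := l2norm_pos hx
      have hc : 0 ≤ β (l2norm x) / l2norm x := div_nonneg (hβ_nonneg _) hpos.le
      rw [hφβ, if_neg hx, l2norm_smul hc, div_mul_cancel₀ _ hpos.ne']
      exact hA_sub _ _
  have hA_le : ∀ x, A (l2norm x) ≤ l2norm x * l2norm (φ x) := fun x => by
    have h := hsub x 0 le_rfl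
    simp only [A, intervalIntegral.integral_same] at h ⊢
    linarith
  set f : (Fin d → ℝ) → ℝ≥0∞ := fun x => ENNReal.ofReal (2 * A (l2norm x))
  set g : (Fin d → ℝ) → ℝ≥0∞ := fun y => radialConjugate A (l2norm y)
  have hf : Measurable f := ((hA_meas.comp measurable_l2norm).const_mul 2).ennreal_ofReal
  have hg : Measurable g := (monotone_radialConjugate A).measurable.comp measurable_l2norm
  have hfg : ∀ x, f x + g (φ x) = ENNReal.ofReal (2 * ∑ i, x i * φ x i) := fun x => by
    have hAx := hA_nonneg _ (l2norm_nonneg x)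
    simp only [f, g, radialConjugate_eq (l2norm_nonneg x) (hsub x)]
    rw [← ENNReal.ofReal_add (by linarith) (by linarith [hA_le x]), hinner]
    congr 1
    ring
  have hfin : ∫⁻ ω, (f (X ω) + g (φ (X ω))) ∂ℙ ≠ ∞ := by
    refine ne_top_of_le_ne_top (hX2.add hφX2).lintegral_lt_top.ne (lintegral_mono fun ω => ?_)
    simp only [hfg, Pi.add_apply]
    refine ENNReal.ofReal_le_ofReal ?_
    linarith [sqDist_add_two_mul_sum (X ω) (φ (X ω)), sqDist_nonneg (X ω) (φ (X ω))]
  rw [lintegral_add_left (show Measurable fun ω => f (X ω) from hf.comp hXmeas),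
    ENNReal.add_ne_top] at hfin
  refine lintegral_sqDist_eq_W2sq_of_potentials hcoup hf hg ?_ ?_ ?_ ?_
  · rw [lintegral_map hf hXmeas]
    exact hfin.1
  · rw [lintegral_map hg hφX]
    exact hfin.2
  · intro x y
    have hCS : ∑ i, x i * y i ≤ l2norm x * l2norm y :=
      Real.sum_mul_le_sqrt_mul_sqrt Finset.univ x y
    rw [← ENNReal.ofReal_add (Finset.sum_nonneg fun _ _ => sq_nonneg _)
      (Finset.sum_nonneg fun _ _ => sq_nonneg _), ← sqDist_add_two_mul_sum]
    refine ENNReal.ofReal_add_le.trans (add_le_add_right ?_ _)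
    calc ENNReal.ofReal (2 * ∑ i, x i * y i)
        ≤ ENNReal.ofReal (2 * A (l2norm x) + 2 * (l2norm x * l2norm y - A (l2norm x))) :=
          ENNReal.ofReal_le_ofReal (by linarith)
      _ ≤ f x + g y := ENNReal.ofReal_add_le.trans
          (add_le_add_right (le_radialConjugate A (l2norm_nonneg x) _) _)
  · have hae : ∀ x, ENNReal.ofReal (sqDist x (φ x)) + (f x + g (φ x)) =
        ENNReal.ofReal (∑ i, x i ^ 2) + ENNReal.ofReal (∑ i, φ x i ^ 2) := fun x => by
      have h0 : 0 ≤ 2 * ∑ i, x i * φ x i := by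
        rw [hinner]
        exact mul_nonneg zero_le_two (mul_nonneg (l2norm_nonneg _) (l2norm_nonneg _))
      rw [hfg, ← ENNReal.ofReal_add (sqDist_nonneg _ _) h0, sqDist_add_two_mul_sum,
        ENNReal.ofReal_add (Finset.sum_nonneg fun _ _ => sq_nonneg _)
          (Finset.sum_nonneg fun _ _ => sq_nonneg _)]
    have hN : Measurable fun x : Fin d → ℝ => ENNReal.ofReal (∑ i, x i ^ 2) := by fun_prop
    refine (ae_map_iff (hXmeas.prodMk hφX).aemeasurable (measurableSet_eq_fun
      (measurable_sqDist.ennreal_ofReal.add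
        ((hf.comp measurable_fst).add (hg.comp measurable_snd)))
      ((hN.comp measurable_fst).add (hN.comp measurable_snd)))).mpr ?_
    exact Filter.Eventually.of_forall fun ω => hae (X ω)
end
end
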